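/- Let (X,d) be a complete generalized metric space and let A : X → X be a self-mapping. Suppose there exist C ≥ 0 and φ : [0,∞) → [0,∞) continuous, nondecreasing, with φ(t) = 0 ⟺ t = 0 and φ(t) < t for t > 0, such that for all x, y ∈ X: d(Ax,Ay) ≤ φ(M(x,y)) + C·min{d(x,Ax), d(y,Ay), d(x,Ay), d(y,Ax)}, where M(x,y) = max{d(x,y), d(x,Ax)(d(y,Ay)+1)/(1+d(x,y)), d(y,Ay)(d(x,Ax)+1)/(1+d(x,y))}. Then A has a unique fixed point in X. -/

import Mathlib

open Filter Topology

/-- A function below the identity on positive reals has no positive point with `t ≤ φ t`. -/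
lemma eq_zero_of_le_of_lt_self {φ : ℝ → ℝ} (hφ_lt : ∀ t, 0 < t → φ t < t) {t : ℝ}
    (ht : 0 ≤ t) (h : t ≤ φ t) : t = 0 := by
  by_contra hne
  exact absurd (hφ_lt t (lt_of_le_of_ne ht (Ne.symm hne))) (not_lt.mpr h)

/-- If `u` converges to `L ≥ 0` and `u` is eventually bounded by `φ (v n) + w n` with
`v → L` and `w → 0`, then `L = 0`. -/
lemma limit_eq_zero_of_le_comparison {φ : ℝ → ℝ} (hφ_cont : ContinuousOn φ (Set.Ici 0))
    (hφ_lt : ∀ t, 0 < t → φ t < t) {u v w : ℕ → ℝ} {L : ℝ} (hL : 0 ≤ L)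
    (hu : Tendsto u atTop (𝓝 L)) (hv : Tendsto v atTop (𝓝 L)) (hv0 : ∀ n, 0 ≤ v n)
    (hw : Tendsto w atTop (𝓝 0)) (h : ∀ᶠ n in atTop, u n ≤ φ (v n) + w n) : L = 0 := by
  refine eq_zero_of_le_of_lt_self hφ_lt hL ?_
  have hφv : Tendsto (fun n => φ (v n)) atTop (𝓝 (φ L)) :=
    (hφ_cont L hL).tendsto.comp
      (tendsto_nhdsWithin_iff.mpr ⟨hv, Eventually.of_forall hv0⟩)
  have := le_of_tendsto_of_tendsto hu (hφv.add hw) h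
  simpa using this

/-- Points of opposite parity along the orbit become arbitrarily close. -/
lemma orbit_odd_close {φ : ℝ → ℝ} {C : ℝ} {e : ℕ → ℕ → ℝ} (hC : 0 ≤ C)
    (hφ_cont : ContinuousOn φ (Set.Ici 0)) (hφ_mono : MonotoneOn φ (Set.Ici 0))
    (hφ_lt : ∀ t, 0 < t → φ t < t)
    (he_nonneg : ∀ n m, 0 ≤ e n m) (he_symm : ∀ n m, e n m = e m n)
    (he_quad : ∀ w x y z : ℕ, w ≠ x → w ≠ y → w ≠ z → x ≠ y → x ≠ z → y ≠ z →
      e w x ≤ e w y + e y z + e z x)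
    (he_succ : Tendsto (fun n => e n (n + 1)) atTop (𝓝 0))
    (hstep : ∀ n m, e (n + 1) (m + 1) ≤ φ (max (e n m)
      (max (e n (n + 1) * (e m (m + 1) + 1)) (e m (m + 1) * (e n (n + 1) + 1))))
        + C * e n (n + 1))
    {ε : ℝ} (hε : 0 < ε) :
    ∃ N, ∀ n m, N ≤ n → N ≤ m → Odd (n + m) → e n m < ε := by
  obtain ⟨δ, hδ, hφδ⟩ : ∃ δ > 0, φ (ε + δ) < ε := by
    have hat : ContinuousAt φ ε := hφ_cont.continuousAt (Ici_mem_nhds hε)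
    obtain ⟨δ, hδ, h⟩ := Metric.eventually_nhds_iff.mp
      (hat.eventually (gt_mem_nhds (hφ_lt ε hε)))
    refine ⟨δ / 2, half_pos hδ, h ?_⟩
    rw [Real.dist_eq, add_sub_cancel_left, abs_of_pos (half_pos hδ)]
    exact half_lt_self hδ
  obtain ⟨σ, hσ, hσ1, hσδ, hσε, hσφ⟩ : ∃ σ > 0, σ ≤ 1 ∧ 2 * σ ≤ δ ∧ σ < ε ∧
      φ (ε + δ) + (C + 2) * σ ≤ ε := by
    have hC2 : 0 < C + 2 := by linarith
    refine ⟨min 1 (min (δ / 2) (min (ε / 2) ((ε - φ (ε + δ)) / (C + 2)))), ?_,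
      min_le_left _ _, ?_, ?_, ?_⟩
    · have := div_pos (sub_pos.mpr hφδ) hC2
      positivity
    · have : min 1 (min (δ / 2) (min (ε / 2) ((ε - φ (ε + δ)) / (C + 2)))) ≤ δ / 2 :=
        (min_le_right _ _).trans (min_le_left _ _)
      linarith
    · have : min 1 (min (δ / 2) (min (ε / 2) ((ε - φ (ε + δ)) / (C + 2)))) ≤ ε / 2 :=
        (min_le_right _ _).trans ((min_le_right _ _).trans (min_le_left _ _))
      linarith
    · have : min 1 (min (δ / 2) (min (ε / 2) ((ε - φ (ε + δ)) / (C + 2))))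
          ≤ (ε - φ (ε + δ)) / (C + 2) :=
        (min_le_right _ _).trans ((min_le_right _ _).trans (min_le_right _ _))
      rw [le_div_iff₀ hC2] at this
      linarith
  obtain ⟨N, hN⟩ := eventually_atTop.mp (he_succ.eventually (gt_mem_nhds hσ))
  have key : ∀ k n, N ≤ n → e n (n + 2 * k + 1) < ε := by
    intro k
    induction k with
    | zero => intro n hn; exact (hN n hn).trans hσε
    | succ k ih =>
      intro n hn
      have h0 := hN n hn
      have h1 := hN (n + 1) (by omega)
      have h3 := ih (n + 2) (by omega)
      rw [show n + 2 + 2 * k + 1 = n + 2 * (k + 1) + 1 by ring] at h3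
      set m := n + 2 * (k + 1) + 1 with hm
      have h2 := hN m (by omega)
      have hq := he_quad n m (n + 1) (n + 2) (by omega) (by omega) (by omega) (by omega)
        (by omega) (by omega)
      have hq' := he_quad n m (n + 1) (m + 1) (by omega) (by omega) (by omega) (by omega)
        (by omega) (by omega)
      have hs := hstep n m
      have hn0 := he_nonneg n (n + 1)
      have hm0 := he_nonneg m (m + 1)
      have hM : max (e n m) (max (e n (n + 1) * (e m (m + 1) + 1))
          (e m (m + 1) * (e n (n + 1) + 1))) ≤ ε + δ := by
        refine max_le (by linarith) (max_le ?_ ?_) <;> nlinarith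
      have hφM := hφ_mono (Set.mem_Ici.mpr ((he_nonneg n m).trans (le_max_left _ _)))
        (Set.mem_Ici.mpr (by positivity)) hM
      have hCσ : C * e n (n + 1) ≤ C * σ := mul_le_mul_of_nonneg_left h0.le hC
      rw [he_symm (m + 1) m] at hq'
      linarith
  refine ⟨N, fun n m hn hm hodd => ?_⟩
  obtain ⟨j, hj⟩ := hodd
  rcases lt_or_ge n m with h | h
  · have := key ((m - n) / 2) n hn
    rwa [show n + 2 * ((m - n) / 2) + 1 = m by omega] at this
  · have := key ((n - m) / 2) m hm
    rwa [show m + 2 * ((n - m) / 2) + 1 = n by omega, he_symm] at this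

/-- The distances between points two steps apart along the orbit tend to zero. -/
lemma orbit_skip_tendsto_zero {φ : ℝ → ℝ} {C : ℝ} {e : ℕ → ℕ → ℝ}
    (hφ_cont : ContinuousOn φ (Set.Ici 0))
    (hφ_lt : ∀ t, 0 < t → φ t < t)
    (he_nonneg : ∀ n m, 0 ≤ e n m)
    (he_quad : ∀ w x y z : ℕ, w ≠ x → w ≠ y → w ≠ z → x ≠ y → x ≠ z → y ≠ z →
      e w x ≤ e w y + e y z + e z x)
    (he_succ : Tendsto (fun n => e n (n + 1)) atTop (𝓝 0))
    (hstep : ∀ n m, e (n + 1) (m + 1) ≤ φ (max (e n m)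
      (max (e n (n + 1) * (e m (m + 1) + 1)) (e m (m + 1) * (e n (n + 1) + 1))))
        + C * e n (n + 1))
    (hodd : ∀ ε > 0, ∃ N, ∀ n m, N ≤ n → N ≤ m → Odd (n + m) → e n m < ε) :
    Tendsto (fun n => e n (n + 2)) atTop (𝓝 0) := by
  have hcauchy : CauchySeq (fun n => e n (n + 2)) := by
    rw [Metric.cauchySeq_iff]
    intro ε hε
    obtain ⟨N, hN⟩ := hodd (ε / 4) (by positivity)
    have one_sided : ∀ n m, N ≤ n → N ≤ m → Odd (n + m) →
        e n (n + 2) < e m (m + 2) + ε / 2 := by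
      intro n m hn hm h
      have h1 := hN n m hn hm h
      have h2 := hN (m + 2) (n + 2) (by omega) (by omega) (by grind)
      obtain ⟨j, hj⟩ := h
      have := he_quad n (n + 2) m (m + 2) (by omega) (by omega) (by omega) (by omega)
        (by omega) (by omega)
      linarith
    refine ⟨N, fun m hm n hn => ?_⟩
    rw [Real.dist_eq, abs_lt]
    rcases Nat.even_or_odd (m + n) with h | h
    · have h1 := one_sided m (n + 1) hm (by omega) (by grind)
      have h2 := one_sided (n + 1) n (by omega) hn (by grind)
      have h3 := one_sided n (n + 1) hn (by omega) (by grind)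
      have h4 := one_sided (n + 1) m (by omega) hm (by grind)
      constructor <;> linarith
    · have h1 := one_sided m n hm hn h
      have h2 := one_sided n m hn hm (by grind)
      constructor <;> linarith
  obtain ⟨L, hL⟩ := cauchySeq_tendsto_of_complete hcauchy
  have hL0 : 0 ≤ L := ge_of_tendsto' hL fun n => he_nonneg _ _
  have he_succ' := (tendsto_add_atTop_iff_nat 2).mpr he_succ
  have hM := hL.max ((he_succ.mul (he_succ'.add_const 1)).max
    (he_succ'.mul (he_succ.add_const 1)))
  simp only [zero_mul, max_self, max_eq_left hL0] at hM
  have hw := he_succ.const_mul C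
  rw [mul_zero] at hw
  have := limit_eq_zero_of_le_comparison hφ_cont hφ_lt hL0
    ((tendsto_add_atTop_iff_nat 1).mpr hL) hM
    (fun n => (he_nonneg _ _).trans (le_max_left _ _)) hw
    (Eventually.of_forall fun n => hstep n (n + 2))
  rwa [this] at hL

/-- An orbit whose opposite-parity distances and two-step distances are small is Cauchy. -/
lemma orbit_cauchy {e : ℕ → ℕ → ℝ}
    (he_quad : ∀ w x y z : ℕ, w ≠ x → w ≠ y → w ≠ z → x ≠ y → x ≠ z → y ≠ z →
      e w x ≤ e w y + e y z + e z x)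
    (hodd : ∀ ε > 0, ∃ N, ∀ n m, N ≤ n → N ≤ m → Odd (n + m) → e n m < ε)
    (hskip : Tendsto (fun n => e n (n + 2)) atTop (𝓝 0)) {ε : ℝ} (hε : 0 < ε) :
    ∃ K, ∀ n m, K ≤ n → n < m → e n m < ε := by
  obtain ⟨N, hN⟩ := hodd (ε / 3) (by positivity)
  obtain ⟨N', hN'⟩ := eventually_atTop.mp
    (hskip.eventually (gt_mem_nhds (show 0 < ε / 3 by positivity)))
  refine ⟨max N N', fun n m hn hnm => ?_⟩
  have hnN : N ≤ n := (le_max_left _ _).trans hn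
  have h2 := hN' n ((le_max_right _ _).trans hn)
  rcases Nat.even_or_odd (n + m) with h | h
  · by_cases hm : m = n + 2
    · subst hm; linarith
    have h3 := hN (n + 2) (n + 3) (by omega) (by omega) (by grind)
    have h4 := hN (n + 3) m (by omega) (by omega) (by grind)
    obtain ⟨j, hj⟩ := h
    have := he_quad n m (n + 2) (n + 3) (by omega) (by omega) (by omega) (by omega)
      (by omega) (by omega)
    linarith
  · have := hN n m hnN (by omega) h
    linarith

/-- **Corollary 3.2.** A rational-type contraction self-map of a complete generalized metric
space has a unique fixed point. -/
theorem fixed_point_rational_contraction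
    {X : Type*} [Nonempty X] (d : X → X → ℝ)
    (hd_nonneg : ∀ x y, 0 ≤ d x y)
    (hd_eq : ∀ x y, d x y = 0 ↔ x = y)
    (hd_symm : ∀ x y, d x y = d y x)
    (hd_quad : ∀ w x y z : X, w ≠ x → w ≠ y → w ≠ z → x ≠ y → x ≠ z → y ≠ z →
      d w x ≤ d w y + d y z + d z x)
    (hcomplete : ∀ s : ℕ → X,
      (∀ ε > (0 : ℝ), ∃ K : ℕ, ∀ r s', K ≤ s' → s' < r → d (s r) (s s') < ε) →
      ∃ x : X, Filter.Tendsto (fun n => d (s n) x) Filter.atTop (nhds 0))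
    (A : X → X)
    (C : ℝ) (hC : 0 ≤ C)
    (φ : ℝ → ℝ)
    (hφ_nonneg : ∀ t, 0 ≤ t → 0 ≤ φ t)
    (hφ_cont : ContinuousOn φ (Set.Ici 0))
    (hφ_mono : MonotoneOn φ (Set.Ici 0))
    (hφ_zero : ∀ t, 0 ≤ t → (φ t = 0 ↔ t = 0))
    (hφ_lt : ∀ t, 0 < t → φ t < t)
    (hcontr : ∀ x y : X,
      d (A x) (A y) ≤
        φ (max (d x y)
            (max (d x (A x) * (d y (A y) + 1) / (1 + d x y))
                 (d y (A y) * (d x (A x) + 1) / (1 + d x y))))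
        + C * min (min (d x (A x)) (d y (A y)))
                  (min (d x (A y)) (d y (A x)))) :
    ∃! z : X, A z = z := by
  have hd_self : ∀ x, d x x = 0 := fun x => (hd_eq x x).mpr rfl
  have huniq : ∀ z w, A z = z → A w = w → w = z := by
    intro z w hz hw
    have h := hcontr w z
    simp only [hz, hw, hd_self, zero_mul, zero_div, max_self, min_self] at h
    rw [max_eq_left (hd_nonneg _ _),
      min_eq_left (le_min (hd_nonneg w z) (hd_nonneg z w)), mul_zero, add_zero] at h
    exact (hd_eq w z).mp (eq_zero_of_le_of_lt_self hφ_lt (hd_nonneg _ _) h)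
  suffices hex : ∃ z, A z = z by
    obtain ⟨z, hz⟩ := hex
    exact ⟨z, hz, fun w hw => huniq z w hz hw⟩
  by_contra hfix
  push Not at hfix
  have hpos : ∀ x, 0 < d x (A x) := fun x =>
    lt_of_le_of_ne (hd_nonneg _ _) fun h => hfix x ((hd_eq _ _).mp h.symm).symm
  have hcontr' : ∀ x y, d (A x) (A y) ≤ φ (max (d x y) (max (d x (A x) * (d y (A y) + 1))
      (d y (A y) * (d x (A x) + 1)))) + C * d x (A x) := by
    intro x y
    have hx := (hpos x).le
    have hy := (hpos y).le
    have hxy := hd_nonneg x y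
    refine (hcontr x y).trans (add_le_add (hφ_mono ?_ ?_ ?_) ?_)
    · exact Set.mem_Ici.mpr (hxy.trans (le_max_left _ _))
    · exact Set.mem_Ici.mpr (hxy.trans (le_max_left _ _))
    · exact max_le_max le_rfl (max_le_max (div_le_self (by positivity) (by linarith))
        (div_le_self (by positivity) (by linarith)))
    · exact mul_le_mul_of_nonneg_left ((min_le_left _ _).trans (min_le_left _ _)) hC
  have hdecr : ∀ x, d (A x) (A (A x)) ≤ φ (d x (A x)) := by
    intro x
    have h := hcontr x (A x)
    have ha := hpos x
    have hb := hpos (A x)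
    have hmin : min (min (d x (A x)) (d (A x) (A (A x))))
        (min (d x (A (A x))) (d (A x) (A x))) = 0 := by
      rw [hd_self, min_eq_right (hd_nonneg x _)]
      exact min_eq_right (le_min ha.le hb.le)
    rw [hmin, mul_zero, add_zero, add_comm 1 (d x (A x)),
      mul_div_cancel_right₀ _ (by linarith)] at h
    · generalize d x (A x) = a at *
      generalize d (A x) (A (A x)) = b at *
      have hM : max a (max (a * (b + 1) / (a + 1)) b) = max a b := by
        apply le_antisymm
        · refine max_le (le_max_left _ _) (max_le ?_ (le_max_right _ _))
          rw [div_le_iff₀ (by linarith)]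
          rcases le_total a b with hab | hab
          · rw [max_eq_right hab]; nlinarith
          · rw [max_eq_left hab]; nlinarith
        · exact max_le_max le_rfl (le_max_right _ _)
      rw [hM] at h
      rcases le_total b a with hab | hab
      · rwa [max_eq_left hab] at h
      · rw [max_eq_right hab] at h
        exact absurd (hφ_lt b hb) (not_lt.mpr h)
  obtain ⟨x₀⟩ := ‹Nonempty X›
  set x : ℕ → X := fun n => A^[n] x₀
  have hsucc : ∀ n, x (n + 1) = A (x n) := fun n => Function.iterate_succ_apply' A n x₀
  have hanti : StrictAnti fun n => d (x n) (A (x n)) := by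
    refine strictAnti_nat_of_succ_lt fun n => ?_
    rw [hsucc]
    exact (hdecr _).trans_lt (hφ_lt _ (hpos _))
  have hinj : Function.Injective x := fun n m h => hanti.injective (by simp only [h])
  obtain ⟨L, hL⟩ : ∃ L, Tendsto (fun n => d (x n) (A (x n))) atTop (𝓝 L) :=
    ⟨_, tendsto_atTop_ciInf hanti.antitone ⟨0, by rintro _ ⟨n, rfl⟩; exact hd_nonneg _ _⟩⟩
  have hL0 : L = 0 := by
    refine limit_eq_zero_of_le_comparison hφ_cont hφ_lt
      (ge_of_tendsto' hL fun n => hd_nonneg _ _) ((tendsto_add_atTop_iff_nat 1).mpr hL) hL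
      (fun n => hd_nonneg _ _) tendsto_const_nhds (Eventually.of_forall fun n => ?_)
    rw [hsucc, add_zero]
    exact hdecr _
  rw [hL0] at hL
  have he_quad : ∀ i j k l : ℕ, i ≠ j → i ≠ k → i ≠ l → j ≠ k → j ≠ l → k ≠ l →
      d (x i) (x j) ≤ d (x i) (x k) + d (x k) (x l) + d (x l) (x j) := by
    intro i j k l h1 h2 h3 h4 h5 h6
    exact hd_quad _ _ _ _ (hinj.ne h1) (hinj.ne h2) (hinj.ne h3) (hinj.ne h4) (hinj.ne h5)
      (hinj.ne h6)
  have he_succ : Tendsto (fun n => d (x n) (x (n + 1))) atTop (𝓝 0) := by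
    simpa only [hsucc] using hL
  have hstep : ∀ n m, d (x (n + 1)) (x (m + 1)) ≤ φ (max (d (x n) (x m))
      (max (d (x n) (x (n + 1)) * (d (x m) (x (m + 1)) + 1))
        (d (x m) (x (m + 1)) * (d (x n) (x (n + 1)) + 1))))
        + C * d (x n) (x (n + 1)) := by
    intro n m
    simp only [hsucc]
    exact hcontr' _ _
  have hodd : ∀ ε > 0, ∃ N, ∀ n m, N ≤ n → N ≤ m → Odd (n + m) → d (x n) (x m) < ε :=
    fun ε hε => orbit_odd_close (e := fun n m => d (x n) (x m)) hC hφ_cont hφ_mono hφ_lt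
      (fun _ _ => hd_nonneg _ _) (fun _ _ => hd_symm _ _) he_quad he_succ hstep hε
  have hskip := orbit_skip_tendsto_zero (e := fun n m => d (x n) (x m)) hφ_cont hφ_lt
    (fun _ _ => hd_nonneg _ _) he_quad he_succ hstep hodd
  obtain ⟨z, hz⟩ := hcomplete x fun ε hε => by
    obtain ⟨K, hK⟩ := orbit_cauchy (e := fun n m => d (x n) (x m)) he_quad hodd hskip hε
    refine ⟨K, fun r s hs hr => ?_⟩
    rw [hd_symm]
    exact hK s r hs hr
  have hne : ∀ y, ∀ᶠ n in atTop, x n ≠ y := by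
    intro y
    have := hinj.tendsto_cofinite.eventually ((Set.finite_singleton y).compl_mem_cofinite)
    rwa [Nat.cofinite_eq_atTop] at this
  have hp := hpos z
  have hone := hz.const_add 1
  rw [add_zero] at hone
  have hM := hz.max (((hL.mul_const (d z (A z) + 1)).div hone one_ne_zero).max
    (((hL.add_const 1).const_mul (d z (A z))).div hone one_ne_zero))
  simp only [Pi.div_apply, zero_mul, zero_add, mul_one, div_one, max_eq_right hp.le] at hM
  have hw := (hL.const_mul C).add (hz.add hL)
  simp only [mul_zero, add_zero] at hw
  refine hp.ne' (limit_eq_zero_of_le_comparison hφ_cont hφ_lt hp.le tendsto_const_nhds hM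
    (fun n => (hd_nonneg _ _).trans (le_max_left _ _)) hw ?_)
  filter_upwards [hne z, hne (A z), (tendsto_add_atTop_nat 1).eventually (hne z),
    (tendsto_add_atTop_nat 1).eventually (hne (A z))] with n h1 h2 h3 h4
  rw [hsucc] at h3 h4
  have hxA : x n ≠ A (x n) := (hfix _).symm
  have hq := hd_quad z (A z) (x n) (A (x n)) (hfix z).symm h1.symm h3.symm h2.symm h4.symm hxA
  have hc := (hcontr (x n) z).trans (add_le_add_right (mul_le_mul_of_nonneg_left
    ((min_le_left _ _).trans (min_le_left _ _)) hC) _)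
  rw [hd_symm z (x n)] at hq
  linarith
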